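/- Let Λ = ℤ^7 with basis H, E₁, …, E₆ and bilinear form ⟨H,H⟩ = 1, ⟨Eᵢ,Eᵢ⟩ = −1, other pairings 0, K = −3H + ΣEᵢ, γ = 2H − ΣEᵢ, and let R be the set of roots (v with ⟨v,v⟩ = −2, ⟨v,K⟩ = 0). Then the action on R of the two-element group generated by the reflection s_γ(v) = v + ⟨v,γ⟩·γ has exactly 51 orbits. -/

import Mathlib

open Finset

/-- The Picard lattice Λ = ℤ^7 of the blow-up of ℙ² in 6 points:
index 0 is the class H, index `i.succ` is the exceptional class Eᵢ. -/
abbrev Pic7 : Type := Fin 7 → ℤ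

/-- The symmetric bilinear form: ⟨H,H⟩ = 1, ⟨Eᵢ,Eᵢ⟩ = −1, other pairings of
distinct basis vectors 0. -/
def form (v w : Pic7) : ℤ := v 0 * w 0 - ∑ i : Fin 6, v i.succ * w i.succ

/-- The hyperplane class H. -/
def Hc : Pic7 := Pi.single 0 1

/-- The exceptional classes E₁, …, E₆. -/
def Ec (i : Fin 6) : Pic7 := Pi.single i.succ 1

/-- The canonical class K = −3H + E₁ + ⋯ + E₆. -/
def Kc : Pic7 := (-3 : ℤ) • Hc + ∑ i : Fin 6, Ec i

/-- γ = 2H − E₁ − ⋯ − E₆. -/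
def γc : Pic7 := (2 : ℤ) • Hc - ∑ i : Fin 6, Ec i

/-- The set of roots of K^⊥: v with ⟨v,v⟩ = −2 and ⟨v,K⟩ = 0. -/
def RootSet : Set Pic7 := {v | form v v = -2 ∧ form v Kc = 0}

/-- The reflection s_γ(v) = v + ⟨v,γ⟩·γ. -/
def sγ (v : Pic7) : Pic7 := v + form v γc • γc

lemma form_self (v : Pic7) : form v v = v 0 ^ 2 - ∑ i : Fin 6, v i.succ ^ 2 := by
  simp only [form, sq]

lemma Kc_zero : Kc 0 = -3 := by decide

lemma Kc_succ (i : Fin 6) : Kc i.succ = 1 := by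
  revert i; decide

lemma γc_zero : γc 0 = 2 := by decide

lemma γc_succ (i : Fin 6) : γc i.succ = -1 := by
  revert i; decide

lemma form_Kc (v : Pic7) : form v Kc = -(3 * v 0 + ∑ i : Fin 6, v i.succ) := by
  simp only [form, Kc_zero, Kc_succ, mul_one]
  ring

lemma form_γc (v : Pic7) : form v γc = 2 * v 0 + ∑ i : Fin 6, v i.succ := by
  simp only [form, γc_zero, γc_succ, mul_neg, mul_one, sum_neg_distrib]
  ring

lemma mem_rootSet_iff (v : Pic7) :
    v ∈ RootSet ↔ ∑ i : Fin 6, v i.succ ^ 2 = v 0 ^ 2 + 2 ∧ ∑ i : Fin 6, v i.succ = -3 * v 0 := by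
  simp only [RootSet, Set.mem_ofPred_eq, form_self, form_Kc]
  constructor <;> rintro ⟨h, h'⟩ <;> constructor <;> linarith

/-- On roots the pairing with `γ` is minus the `H`-coefficient. -/
lemma sγ_eq_sub {v : Pic7} (hv : v ∈ RootSet) : sγ v = v - v 0 • γc := by
  rw [mem_rootSet_iff] at hv
  rw [sγ, form_γc, hv.2, sub_eq_add_neg, ← neg_smul]
  congr 2
  ring

lemma sγ_apply_zero {v : Pic7} (hv : v ∈ RootSet) : sγ v 0 = -v 0 := by
  rw [sγ_eq_sub hv]
  simp only [Pi.sub_apply, Pi.smul_apply, γc_zero, smul_eq_mul]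
  ring

lemma sγ_mem_rootSet {v : Pic7} (hv : v ∈ RootSet) : sγ v ∈ RootSet := by
  rw [mem_rootSet_iff, sγ_apply_zero hv, sγ_eq_sub hv]
  rw [mem_rootSet_iff] at hv
  simp only [Fin.sum_univ_six, Pi.sub_apply, Pi.smul_apply, γc_succ, smul_eq_mul] at hv ⊢
  constructor
  · linear_combination hv.1 + 2 * v 0 * hv.2
  · linear_combination hv.2

lemma sγ_sγ {v : Pic7} (hv : v ∈ RootSet) : sγ (sγ v) = v := by
  rw [sγ_eq_sub (sγ_mem_rootSet hv), sγ_apply_zero hv, sγ_eq_sub hv]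
  module

lemma sγ_eq_self {v : Pic7} (hv : v ∈ RootSet) (h : v 0 = 0) : sγ v = v := by
  simp [sγ_eq_sub hv, h]

/-- The `s_γ`-orbits of roots are represented by the roots with nonnegative `H`-coefficient. -/
lemma setOf_orbits_eq_image :
    {O : Set Pic7 | ∃ v ∈ RootSet, O = {v, sγ v}} =
      (fun v : Pic7 => ({v, sγ v} : Set Pic7)) '' {v | v ∈ RootSet ∧ 0 ≤ v 0} := by
  ext O
  constructor
  · rintro ⟨v, hv, rfl⟩
    rcases le_total 0 (v 0) with h | h
    · exact ⟨v, ⟨hv, h⟩, rfl⟩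
    · refine ⟨sγ v, ⟨sγ_mem_rootSet hv, ?_⟩, ?_⟩
      · rw [sγ_apply_zero hv]
        exact neg_nonneg.mpr h
      · simp only [sγ_sγ hv, Set.pair_comm]
  · rintro ⟨v, ⟨hv, -⟩, rfl⟩
    exact ⟨v, hv, rfl⟩

lemma injOn_orbit :
    Set.InjOn (fun v : Pic7 => ({v, sγ v} : Set Pic7)) {v | v ∈ RootSet ∧ 0 ≤ v 0} := by
  rintro v ⟨hv, hv0⟩ w ⟨hw, hw0⟩ hvw
  have hmem : v ∈ ({w, sγ w} : Set Pic7) := by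
    rw [← show ({v, sγ v} : Set Pic7) = {w, sγ w} from hvw]
    exact Set.mem_insert _ _
  rcases hmem with h | h
  · exact h
  · have h' : v = sγ w := h
    have hw0' : w 0 = 0 := by
      have := sγ_apply_zero hw
      rw [← h'] at this
      omega
    rw [h', sγ_eq_self hw hw0']

/-- A finite set of integer vectors containing all roots with nonnegative `H`-coefficient. -/
def rootBox : Finset Pic7 :=
  Fintype.piFinset (Fin.cons {0, 1, 2} fun _ : Fin 6 => {-1, 0, 1})

lemma mem_rootBox {v : Pic7} (hv : v ∈ RootSet) (h0 : 0 ≤ v 0) : v ∈ rootBox := by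
  rw [mem_rootSet_iff] at hv
  obtain ⟨hsq, hsum⟩ := hv
  have hcs := sq_sum_le_card_mul_sum_sq (s := (univ : Finset (Fin 6))) (f := fun i => v i.succ)
  rw [hsq, hsum] at hcs
  simp only [card_univ, Fintype.card_fin, Nat.cast_ofNat] at hcs
  have h2 : v 0 ≤ 2 := by nlinarith
  rw [rootBox, Fintype.mem_piFinset, Fin.forall_fin_succ]
  refine ⟨?_, fun i => ?_⟩
  · simp only [Fin.cons_zero, mem_insert, mem_singleton]
    omega
  · have hvar : ∑ i : Fin 6, (2 * v i.succ + v 0) ^ 2 = 8 - 2 * v 0 ^ 2 := by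
      simp only [Fin.sum_univ_six] at hsq hsum ⊢
      linear_combination 4 * hsq + 4 * v 0 * hsum
    have hle : (2 * v i.succ + v 0) ^ 2 ≤ 8 - 2 * v 0 ^ 2 :=
      hvar ▸ single_le_sum (f := fun i : Fin 6 => (2 * v i.succ + v 0) ^ 2)
        (fun _ _ => sq_nonneg _) (mem_univ i)
    have hlow : -1 ≤ v i.succ := by
      interval_cases v 0 <;> nlinarith
    have hupp : v i.succ ≤ 1 := by nlinarith
    simp only [Fin.cons_succ, mem_insert, mem_singleton]
    omega

lemma card_filter_rootBox :
    #{v ∈ rootBox | ∑ i : Fin 6, v i.succ ^ 2 = v 0 ^ 2 + 2 ∧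
      ∑ i : Fin 6, v i.succ = -3 * v 0} = 51 := by
  decide +kernel

/-- The action on the 72 roots of the two-element group generated by the
reflection s_γ has exactly 51 orbits: the orbit of a root v is {v, s_γ v}. -/
theorem sγ_orbits_card_51 :
    Set.ncard {O : Set Pic7 | ∃ v ∈ RootSet, O = {v, sγ v}} = 51 := by
  rw [setOf_orbits_eq_image, injOn_orbit.ncard_image, ← card_filter_rootBox,
    ← Set.ncard_coe_finset]
  congr 1
  ext v
  simp only [coe_filter, Set.mem_ofPred_eq, ← mem_rootSet_iff]
  constructor
  · rintro ⟨hv, h0⟩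
    exact ⟨mem_rootBox hv h0, hv⟩
  · rintro ⟨hbox, hv⟩
    have h0 := Fintype.mem_piFinset.mp hbox 0
    simp only [Fin.cons_zero, mem_insert, mem_singleton] at h0
    exact ⟨hv, by omega⟩
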